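/- For every r_f > 0 there exists a constant C > 0 such that for all x, y ∈ ℝ² with x ≠ y and a = |x − y|/2, and all 0 < d₋ ≤ d₊ ≤ r_f with a ≤ (3/4)·d₋, the Lebesgue area of D_{d₋,d₊}(x,y) is at most C·(d₊ − d₋). -/

import Mathlib

open MeasureTheory Real
open scoped Classical

noncomputable section

/-- The Euclidean plane. -/
abbrev E2 : Type := EuclideanSpace ℝ (Fin 2)

/-- Rotation of a planar vector by `π/2`; it is orthogonal to `v` and has the same norm. -/
def perp (v : E2) : E2 := (WithLp.equiv 2 (Fin 2 → ℝ)).symm ![-(v 1), v 0]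

/-- For `d ≥ a := |x − y|/2`, the closed disk of radius `d` whose boundary circle passes
through `x` and `y`, with center `midpoint x y + sgn·√(d² − a²)·n`, where `n` is the unit
vector orthogonal to `y − x` obtained by normalizing `perp (y - x)`; for `d < a` it is
empty.  `sgn = 1` gives `B_d^+(x,y)` and `sgn = -1` gives `B_d^-(x,y)`. -/
def diskPM (x y : E2) (d : ℝ) (sgn : ℝ) : Set E2 :=
  if d < ‖y - x‖ / 2 then ∅
  else Metric.closedBall
    (midpoint ℝ x y + ((sgn * Real.sqrt (d ^ 2 - (‖y - x‖ / 2) ^ 2)) / ‖y - x‖) • perp (y - x)) d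

/-- The set `D_{d₋,d₊}(x,y)` of points `z` such that the boundaries of the three equal disks
around `x`, `y`, `z` meet at a time `r` with `d₋ < r ≤ d₊`; empty when `x = y`. -/
def Dset (x y : E2) (dm dp : ℝ) : Set E2 :=
  if x = y then ∅
  else
    (diskPM x y dp 1 ∪ diskPM x y dp (-1)) \
      (diskPM x y (max dm (‖y - x‖ / 2)) 1 ∪ diskPM x y (max dm (‖y - x‖ / 2)) (-1))

end

lemma norm_perp_eq (v : E2) : ‖perp v‖ = ‖v‖ := by
  simp [EuclideanSpace.norm_eq, perp, Fin.sum_univ_two, add_comm]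

lemma real_vol_closedBall (c : E2) (r : ℝ) (hr : 0 ≤ r) :
    volume.real (Metric.closedBall c r) = r ^ 2 * π := by
  rw [Measure.real, EuclideanSpace.volume_closedBall_fin_two]
  simp [ENNReal.toReal_ofReal hr, ENNReal.toReal_ofReal Real.pi_pos.le]

lemma vol_diff_le (c c' : E2) (p m s : ℝ) (hm : 0 ≤ m) (hp : m ≤ p) (h : dist c c' ≤ s) :
    volume.real (Metric.closedBall c p \ Metric.closedBall c' m) ≤
      π * ((p + s) ^ 2 - m ^ 2) := by
  have hs : 0 ≤ s := dist_nonneg.trans h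
  have h1 : Metric.closedBall c p ⊆ Metric.closedBall c' (p + s) :=
    Metric.closedBall_subset_closedBall' (by linarith)
  have h2 : Metric.closedBall c' m ⊆ Metric.closedBall c' (p + s) :=
    Metric.closedBall_subset_closedBall (by linarith)
  have hf : volume (Metric.closedBall c' (p + s) \ Metric.closedBall c' m) ≠ ⊤ :=
    ((measure_mono Set.diff_subset).trans_lt measure_closedBall_lt_top).ne
  calc _ ≤ volume.real (Metric.closedBall c' (p + s) \ Metric.closedBall c' m) :=
        measureReal_mono (Set.diff_subset_diff_left h1) hf
    _ = _ := by
        rw [measureReal_diff h2 Metric.isClosed_closedBall.measurableSet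
          measure_closedBall_lt_top.ne, real_vol_closedBall _ _ (by linarith),
          real_vol_closedBall _ _ hm]
        ring

lemma sqrt_shift (a m p : ℝ) (ha : 0 ≤ a) (hm : 0 < m) (hp : m ≤ p) (ham : a ≤ 3 / 4 * m) :
    |√(p ^ 2 - a ^ 2) - √(m ^ 2 - a ^ 2)| ≤ 2 * (p - m) := by
  have hA : m / 2 ≤ √(m ^ 2 - a ^ 2) := Real.le_sqrt_of_sq_le (by nlinarith)
  have hB : p / 2 ≤ √(p ^ 2 - a ^ 2) := Real.le_sqrt_of_sq_le (by nlinarith)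
  have h1 := Real.sq_sqrt (show 0 ≤ m ^ 2 - a ^ 2 by nlinarith)
  have h2 := Real.sq_sqrt (show 0 ≤ p ^ 2 - a ^ 2 by nlinarith)
  have hle : √(m ^ 2 - a ^ 2) ≤ √(p ^ 2 - a ^ 2) := Real.sqrt_le_sqrt (by nlinarith)
  rw [abs_of_nonneg (by linarith)]
  set A := √(m ^ 2 - a ^ 2)
  set B := √(p ^ 2 - a ^ 2)
  by_contra! hc
  have : (B - A) * (A + B) = (p - m) * (p + m) := by nlinarith
  nlinarith

lemma diskPM_diff_le (rf : ℝ) (x y : E2) (hxy : x ≠ y) (m p σ : ℝ) (hσ : |σ| = 1) (hm : 0 < m)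
    (hp : m ≤ p) (hpr : p ≤ rf) (ham : ‖y - x‖ / 2 ≤ 3 / 4 * m) :
    volume.real (diskPM x y p σ \ diskPM x y m σ) ≤ 12 * π * rf * (p - m) := by
  have hn : 0 < ‖y - x‖ := norm_pos_iff.2 (sub_ne_zero.2 hxy.symm)
  rw [diskPM, diskPM, if_neg (by linarith), if_neg (by linarith)]
  refine (vol_diff_le _ _ p m (2 * (p - m)) hm.le hp ?_).trans ?_
  · rw [dist_add_left, dist_eq_norm, ← sub_smul, norm_smul, norm_perp_eq, ← sub_div, ← mul_sub,
      Real.norm_eq_abs, abs_div, abs_mul, hσ, one_mul, abs_of_pos hn, div_mul_cancel₀ _ hn.ne']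
    exact sqrt_shift _ _ _ (by linarith) hm hp ham
  · have : (p + 2 * (p - m)) ^ 2 - m ^ 2 ≤ 12 * rf * (p - m) := by
      nlinarith [mul_nonneg (sub_nonneg.2 hp) (sub_nonneg.2 hpr), mul_nonneg (sub_nonneg.2 hp) hm.le]
    nlinarith [mul_le_mul_of_nonneg_left this Real.pi_pos.le]

/-- **Improved area bound for `D_{d₋,d₊}` when the chord is short.** For every `r_f > 0`
there is a constant `C > 0` such that for all `x ≠ y` with `a = |x − y|/2` and all
`0 < d₋ ≤ d₊ ≤ r_f` with `a ≤ (3/4)·d₋`, the Lebesgue area of `D_{d₋,d₊}(x,y)`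
is at most `C·(d₊ − d₋)`. -/
theorem area_Dset_le_of_small_chord (rf : ℝ) (hrf : 0 < rf) :
    ∃ C > 0, ∀ (x y : E2), x ≠ y → ∀ (a : ℝ), a = ‖x - y‖ / 2 →
      ∀ (dm dp : ℝ), 0 < dm → dm ≤ dp → dp ≤ rf → a ≤ (3 / 4) * dm →
      (volume (Dset x y dm dp)).toReal ≤ C * (dp - dm) := by
  refine ⟨24 * π * rf, by positivity, ?_⟩
  intro x y hxy a ha m p hm hmp hpr ham
  have ham' : ‖y - x‖ / 2 ≤ 3 / 4 * m := by rw [norm_sub_rev, ← ha]; exact ham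
  have hfin : ∀ σ, volume (diskPM x y p σ \ diskPM x y m σ) ≠ ⊤ := by
    intro σ
    refine ((measure_mono Set.diff_subset).trans_lt ?_).ne
    rw [diskPM, if_neg (by linarith)]
    exact measure_closedBall_lt_top
  have h1 := diskPM_diff_le rf x y hxy m p 1 (by simp) hm hmp hpr ham'
  have h2 := diskPM_diff_le rf x y hxy m p (-1) (by simp) hm hmp hpr ham'
  have hsub : Dset x y m p ⊆ (diskPM x y p 1 \ diskPM x y m 1) ∪
      (diskPM x y p (-1) \ diskPM x y m (-1)) := by
    rw [Dset, if_neg hxy, max_eq_left (by linarith)]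
    rintro z ⟨h | h, h'⟩
    · exact Or.inl ⟨h, fun k => h' (Or.inl k)⟩
    · exact Or.inr ⟨h, fun k => h' (Or.inr k)⟩
  have h3 : volume.real (Dset x y m p) ≤ _ :=
    measureReal_mono hsub (measure_union_lt_top (hfin 1).lt_top (hfin (-1)).lt_top).ne
  have h4 := h3.trans (measureReal_union_le _ _)
  change volume.real (Dset x y m p) ≤ _
  linarith
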